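/- arXiv:2212.02607 — 3 statements merged into one kernel-verified Lean document; each statement's English description precedes it below -/
import Mathlib

section
/- Let Λ ⊆ (0,∞) be countable. The space (M_Λ, d) has the Urysohn property: if Y is a finite ultrametric space whose spectrum is contained in Λ, X ⊆ Y, and φ : X → M_Λ is an isometric embedding, then φ extends to an isometric embedding of Y into M_Λ. -/
/-- The model `M_Λ` of the ultrametric Urysohn space: functions `ω : Λ → ℤ` such that for
every `ε > 0` the set of `λ ∈ Λ` with `λ ≥ ε` and `ω(λ) ≠ 0` is finite. -/
abbrev UrysohnPt (Λ : Set ℝ) : Type :=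
  {ω : Λ → ℤ // ∀ ε : ℝ, 0 < ε → {l : Λ | ε ≤ (l : ℝ) ∧ ω l ≠ 0}.Finite}

/-- The distance on `M_Λ`: the largest `λ ∈ Λ` at which the two functions differ
(`sSup ∅ = 0` in Mathlib, so `uDist ω ω = 0`). -/
noncomputable def uDist {Λ : Set ℝ} (ω ω' : UrysohnPt Λ) : ℝ :=
  sSup ((fun l : Λ => (l : ℝ)) '' {l : Λ | ω.1 l ≠ ω'.1 l})

theorem uDist_self {Λ : Set ℝ} (ω : UrysohnPt Λ) : uDist ω ω = 0 := by
  simp [uDist]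

theorem uDist_comm {Λ : Set ℝ} (ω ω' : UrysohnPt Λ) : uDist ω ω' = uDist ω' ω := by
  simp only [uDist, ne_comm]

theorem UrysohnPt.finite_setOf_ne {Λ : Set ℝ} (ω ω' : UrysohnPt Λ) {ε : ℝ} (hε : 0 < ε) :
    {l : Λ | ε ≤ (l : ℝ) ∧ ω.1 l ≠ ω'.1 l}.Finite := by
  refine ((ω.2 ε hε).union (ω'.2 ε hε)).subset ?_
  rintro l ⟨hl, hne⟩
  by_cases h : ω.1 l = 0
  · exact Or.inr ⟨hl, fun h' => hne (h.trans h'.symm)⟩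
  · exact Or.inl ⟨hl, h⟩

/-- Distinct points of `M_Λ` differ at a largest index. -/
theorem UrysohnPt.exists_isGreatest_ne {Λ : Set ℝ} (hΛ : ∀ r ∈ Λ, 0 < r) {ω ω' : UrysohnPt Λ}
    (h : ω ≠ ω') : ∃ l : Λ, IsGreatest {l : Λ | ω.1 l ≠ ω'.1 l} l := by
  obtain ⟨k, hk⟩ : ∃ k, ω.1 k ≠ ω'.1 k := by
    by_contra! hall
    exact h (Subtype.ext (funext hall))
  obtain ⟨l, ⟨hkl, hl⟩, hmax⟩ := Set.exists_max_image _ id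
    (UrysohnPt.finite_setOf_ne ω ω' (hΛ k k.2)) ⟨k, le_rfl, hk⟩
  refine ⟨l, hl, fun m hm => ?_⟩
  rcases le_total (k : ℝ) m with hkm | hmk
  · exact hmax m ⟨hkm, hm⟩
  · exact Subtype.coe_le_coe.1 (hmk.trans hkl)

theorem uDist_eq_of_isGreatest {Λ : Set ℝ} {ω ω' : UrysohnPt Λ} {l : Λ}
    (h : IsGreatest {l : Λ | ω.1 l ≠ ω'.1 l} l) : uDist ω ω' = l := by
  refine IsGreatest.csSup_eq ⟨⟨l, h.1, rfl⟩, ?_⟩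
  rintro _ ⟨m, hm, rfl⟩
  exact h.2 hm

theorem uDist_eq_iff {Λ : Set ℝ} (hΛ : ∀ r ∈ Λ, 0 < r) {ω ω' : UrysohnPt Λ} {l : Λ} :
    uDist ω ω' = l ↔ ω.1 l ≠ ω'.1 l ∧ ∀ m, l < m → ω.1 m = ω'.1 m := by
  constructor
  · intro h
    have hne : ω ≠ ω' := by
      rintro rfl
      exact (hΛ l l.2).ne ((uDist_self ω).symm.trans h)
    obtain ⟨k, hk⟩ := UrysohnPt.exists_isGreatest_ne hΛ hne
    obtain rfl : k = l := Subtype.ext ((uDist_eq_of_isGreatest hk).symm.trans h)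
    refine ⟨hk.1, fun m hm => ?_⟩
    by_contra hm'
    exact (hk.2 hm').not_gt hm
  · rintro ⟨hl, hagree⟩
    refine uDist_eq_of_isGreatest ⟨hl, fun m hm => ?_⟩
    by_contra! hlt
    exact hm (hagree m hlt)

/-- Points of `M_Λ` agree at every index exceeding their distance. -/
theorem UrysohnPt.eq_of_uDist_lt {Λ : Set ℝ} (hΛ : ∀ r ∈ Λ, 0 < r) {ω ω' : UrysohnPt Λ} {m : Λ}
    (h : uDist ω ω' < m) : ω.1 m = ω'.1 m := by
  by_cases hne : ω = ω'
  · rw [hne]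
  obtain ⟨k, hk⟩ := UrysohnPt.exists_isGreatest_ne hΛ hne
  rw [uDist_eq_of_isGreatest hk] at h
  by_contra hm
  exact (hk.2 hm).not_gt h

open Classical in
/-- The point of `M_Λ` obtained from `ω` by changing its value at `l` to `n`. -/
noncomputable def UrysohnPt.update {Λ : Set ℝ} (ω : UrysohnPt Λ) (l : Λ) (n : ℤ) :
    UrysohnPt Λ :=
  ⟨Function.update ω.1 l n, fun ε hε => by
    refine ((ω.2 ε hε).insert l).subset ?_
    rintro m ⟨hm, hne⟩
    by_cases h : m = l
    · exact Or.inl h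
    · exact Or.inr ⟨hm, by rwa [Function.update_of_ne h] at hne⟩⟩

theorem UrysohnPt.update_self {Λ : Set ℝ} (ω : UrysohnPt Λ) (l : Λ) (n : ℤ) :
    (ω.update l n).1 l = n := by
  simp [UrysohnPt.update]

theorem UrysohnPt.update_of_ne {Λ : Set ℝ} (ω : UrysohnPt Λ) {l m : Λ} (n : ℤ) (h : m ≠ l) :
    (ω.update l n).1 m = ω.1 m := by
  simp [UrysohnPt.update, h]

/-- One-point extension property of `M_Λ`. -/
theorem UrysohnPt.exists_uDist_eq {Λ : Set ℝ} (hΛ : ∀ r ∈ Λ, 0 < r)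
    {Y : Type*} [MetricSpace Y]
    (hYu : ∀ x y z : Y, dist x z ≤ max (dist x y) (dist y z))
    (hYspec : ∀ x y : Y, x ≠ y → dist x y ∈ Λ)
    {S : Set Y} (hS : S.Finite) {Φ : Y → UrysohnPt Λ}
    (hΦ : ∀ a ∈ S, ∀ b ∈ S, uDist (Φ a) (Φ b) = dist a b) {y : Y} (hy : y ∉ S) :
    ∃ ω : UrysohnPt Λ, ∀ s ∈ S, uDist ω (Φ s) = dist y s := by
  rcases S.eq_empty_or_nonempty with rfl | hne
  · exact ⟨⟨0, by simp⟩, by simp⟩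
  obtain ⟨p, hp, hmin⟩ := Set.exists_min_image S (fun s => dist y s) hS hne
  have hspec : ∀ s ∈ S, dist y s ∈ Λ := fun s hs => hYspec y s fun h => hy (h ▸ hs)
  obtain ⟨r, hr⟩ : ∃ r : Λ, (r : ℝ) = dist y p := ⟨⟨_, hspec p hp⟩, rfl⟩
  obtain ⟨n, hn⟩ := (hS.image fun s => (Φ s).1 r).exists_notMem
  refine ⟨(Φ p).update r n, fun s hs => ?_⟩
  have hps : dist p s ≤ max (dist y p) (dist y s) := dist_comm y p ▸ hYu p y s
  have hys : dist y s ≤ max (dist y p) (dist p s) := hYu y p s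
  rcases (hmin s hs).eq_or_lt with heq | hlt
  · rw [← heq, ← hr, uDist_eq_iff hΛ, UrysohnPt.update_self]
    refine ⟨fun h => hn ⟨s, hs, h.symm⟩, fun m hm => ?_⟩
    rw [UrysohnPt.update_of_ne _ _ hm.ne']
    refine UrysohnPt.eq_of_uDist_lt hΛ ?_
    rw [hΦ p hp s hs]
    refine lt_of_le_of_lt hps ?_
    rw [← heq, max_self, ← hr]
    exact hm
  · obtain ⟨t, ht⟩ : ∃ t : Λ, (t : ℝ) = dist y s := ⟨⟨_, hspec s hs⟩, rfl⟩
    have hrt : r < t := Subtype.coe_lt_coe.1 (by rwa [hr, ht])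
    have hdist : dist p s = dist y s :=
      le_antisymm (by rwa [max_eq_right hlt.le] at hps)
        ((le_max_iff.1 hys).resolve_left hlt.not_ge)
    have h := hΦ p hp s hs
    rw [hdist, ← ht, uDist_eq_iff hΛ] at h
    rw [← ht, uDist_eq_iff hΛ, UrysohnPt.update_of_ne _ _ hrt.ne']
    refine ⟨h.1, fun m hm => ?_⟩
    rw [UrysohnPt.update_of_ne _ _ (hrt.trans hm).ne']
    exact h.2 m hm

/-- The Urysohn property of `(M_Λ, uDist)` for countable `Λ ⊆ (0,∞)`: any isometric
embedding into `M_Λ` of a subset `X` of a finite ultrametric space `Y` with spectrum in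
`Λ` extends to an isometric embedding of `Y`. -/
theorem urysohnSpace_urysohn_property
    (Λ : Set ℝ) (hΛc : Λ.Countable) (hΛ : ∀ r ∈ Λ, 0 < r)
    (Y : Type*) [MetricSpace Y] [Finite Y]
    (hYu : ∀ x y z : Y, dist x z ≤ max (dist x y) (dist y z))
    (hYspec : ∀ x y : Y, x ≠ y → dist x y ∈ Λ)
    (X : Set Y) (φ : X → UrysohnPt Λ)
    (hφ : ∀ a b : X, uDist (φ a) (φ b) = dist (a : Y) (b : Y)) :
    ∃ Φ : Y → UrysohnPt Λ, (∀ a b : Y, uDist (Φ a) (Φ b) = dist a b) ∧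
      ∀ x : X, Φ (x : Y) = φ x := by
  classical
  have key : ∀ T : Set Y, T.Finite → ∃ Φ : Y → UrysohnPt Λ,
      (∀ a ∈ X ∪ T, ∀ b ∈ X ∪ T, uDist (Φ a) (Φ b) = dist a b) ∧ ∀ x : X, Φ (x : Y) = φ x := by
    intro T hT
    induction T, hT using Set.Finite.induction_on with
    | empty =>
      refine ⟨fun y => if h : y ∈ X then φ ⟨y, h⟩ else ⟨0, by simp⟩, ?_, fun x => by simp⟩
      intro a ha b hb
      rw [Set.union_empty] at ha hb
      simpa [ha, hb] using hφ ⟨a, ha⟩ ⟨b, hb⟩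
    | @insert y T _ _ ih =>
      obtain ⟨Φ, hΦ, hext⟩ := ih
      rw [Set.union_insert]
      by_cases hy : y ∈ X ∪ T
      · rw [Set.insert_eq_of_mem hy]
        exact ⟨Φ, hΦ, hext⟩
      obtain ⟨ω, hω⟩ := UrysohnPt.exists_uDist_eq hΛ hYu hYspec (Set.toFinite _) hΦ hy
      have hne : ∀ {a}, a ∈ X ∪ T → a ≠ y := fun ha h => hy (h ▸ ha)
      refine ⟨Function.update Φ y ω, ?_, fun x => ?_⟩
      · rintro a (rfl | ha) b (rfl | hb)
        · rw [uDist_self, dist_self]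
        · rw [Function.update_self, Function.update_of_ne (hne hb), hω b hb]
        · rw [Function.update_self, Function.update_of_ne (hne ha), uDist_comm, hω a ha,
            dist_comm]
        · rw [Function.update_of_ne (hne ha), Function.update_of_ne (hne hb), hΦ a ha b hb]
      · rw [Function.update_of_ne (hne (Or.inl x.2)), hext]
  obtain ⟨Φ, hΦ, hext⟩ := key Set.univ Set.finite_univ
  exact ⟨Φ, fun a b => hΦ a (Or.inr trivial) b (Or.inr trivial), hext⟩
end

section
/- Let Λ ⊆ (0,∞) be countable. The space (M_Λ, d) is ultrahomogeneous: if A and B are finite subsets of M_Λ and θ₀ : A → B is a bijection with d(θ₀(a), θ₀(a′)) = d(a, a′) for all a, a′ ∈ A, then there exists a surjective isometry θ : M_Λ → M_Λ with θ(a) = θ₀(a) for all a ∈ A. -/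
section Homogeneous

variable {X : Type*} [MetricSpace X] [IsUltrametricDist X]

/-- In an ultrametric space, an isometry `e` with `e a = b` yields one that exchanges the open
balls of radius `dist a b` around `a` and `b` and fixes every other point. -/
theorem IsUltrametricDist.exists_isometryEquiv_swap {a b : X} (e : X ≃ᵢ X) (he : e a = b) :
    ∃ g : X ≃ᵢ X, g a = b ∧ ∀ x, dist x a = dist x b → g x = x := by
  classical
  rcases eq_or_ne a b with rfl | hab
  · exact ⟨IsometryEquiv.refl X, rfl, fun _ _ => rfl⟩
  have hr : 0 < dist a b := dist_pos.2 hab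
  have hea (x : X) : dist (e x) b = dist x a := by rw [← he, e.dist_eq]
  have heb (x : X) : dist (e.symm x) a = dist x b := by rw [← hea, e.apply_symm_apply]
  have tri (x y z : X) : dist x z ≤ dist x y ∨ dist x z ≤ dist y z :=
    le_max_iff.1 (dist_triangle_max x y z)
  have not_both (x : X) (h : dist x a < dist a b) : ¬ dist x b < dist a b := by
    have := tri a x b
    rw [dist_comm a x] at this
    grind
  -- points of a ball of radius `r` are equidistant from any point outside it
  have far (x y c : X) (r : ℝ) (hx : dist x c < r) (hy : ¬ dist y c < r) :
      dist x y = dist c y := by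
    have h₁ := tri x c y
    have h₂ := tri c x y
    rw [dist_comm c x] at h₂
    rw [dist_comm y c] at hy
    grind
  have outside (y : X) (hya : ¬ dist y a < dist a b) (hyb : ¬ dist y b < dist a b) :
      dist a y = dist b y := by
    have h₁ := tri a b y
    have h₂ := tri b a y
    rw [dist_comm b a] at h₂
    rw [dist_comm y a] at hya
    rw [dist_comm y b] at hyb
    grind
  let f (x : X) : X :=
    if dist x a < dist a b then e x else if dist x b < dist a b then e.symm x else x
  have f_a (x : X) (h : dist x a < dist a b) : f x = e x := if_pos h
  have f_b (x : X) (h : dist x b < dist a b) : f x = e.symm x := by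
    simp only [f, if_neg fun h' => not_both x h' h, if_pos h]
  have f_out (x : X) (h₁ : ¬ dist x a < dist a b) (h₂ : ¬ dist x b < dist a b) : f x = x := by
    simp only [f, if_neg h₁, if_neg h₂]
  have hinv : Function.Involutive f := by
    intro x
    by_cases h₁ : dist x a < dist a b
    · rw [f_a x h₁, f_b _ (by rwa [hea]), e.symm_apply_apply]
    by_cases h₂ : dist x b < dist a b
    · rw [f_b x h₂, f_a _ (by rwa [heb]), e.apply_symm_apply]
    rw [f_out x h₁ h₂, f_out x h₁ h₂]
  have hab_dist (x y : X) (hx : dist x a < dist a b) (hy : dist y b < dist a b) :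
      dist x y = dist a b := by
    rw [far x y a _ hx fun h => not_both y h hy, dist_comm a y,
      far y a b _ hy (lt_irrefl _), dist_comm]
  have out_dist (x y : X) (hx₁ : ¬ dist x a < dist a b) (hx₂ : ¬ dist x b < dist a b) :
      dist (f y) x = dist y x := by
    by_cases h₁ : dist y a < dist a b
    · rw [f_a y h₁, far (e y) x b _ (by rwa [hea]) hx₂, far y x a _ h₁ hx₁, outside x hx₁ hx₂]
    by_cases h₂ : dist y b < dist a b
    · rw [f_b y h₂, far (e.symm y) x a _ (by rwa [heb]) hx₁, far y x b _ h₂ hx₂,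
        outside x hx₁ hx₂]
    rw [f_out y h₁ h₂]
  have hiso : Isometry f := by
    refine Isometry.of_dist_eq fun x y => ?_
    by_cases hx₁ : dist x a < dist a b
    · by_cases hy₁ : dist y a < dist a b
      · rw [f_a x hx₁, f_a y hy₁, e.dist_eq]
      by_cases hy₂ : dist y b < dist a b
      · rw [f_a x hx₁, f_b y hy₂, dist_comm, hab_dist _ _ (by rwa [heb]) (by rwa [hea]),
          hab_dist x y hx₁ hy₂]
      rw [f_out y hy₁ hy₂, out_dist y x hy₁ hy₂]
    by_cases hx₂ : dist x b < dist a b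
    · by_cases hy₁ : dist y a < dist a b
      · rw [f_b x hx₂, f_a y hy₁, hab_dist _ _ (by rwa [heb]) (by rwa [hea]), dist_comm x,
          hab_dist y x hy₁ hx₂]
      by_cases hy₂ : dist y b < dist a b
      · rw [f_b x hx₂, f_b y hy₂, e.symm.dist_eq]
      rw [f_out y hy₁ hy₂, out_dist y x hy₁ hy₂]
    rw [f_out x hx₁ hx₂, dist_comm, out_dist x y hx₁ hx₂, dist_comm]
  refine ⟨⟨hinv.toPerm f, hiso⟩, (f_a a (by simpa using hr)).trans he, fun x hx => ?_⟩
  have hx' : ¬ dist x a < dist a b := fun h => not_both x h (hx ▸ h)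
  exact f_out x hx' (hx ▸ hx')

/-- A homogeneous ultrametric space is ultrahomogeneous. -/
theorem exists_isometryEquiv_eqOn_of_homogeneous (h : ∀ a b : X, ∃ e : X ≃ᵢ X, e a = b)
    {s : Set X} (hs : s.Finite) {f : X → X}
    (hf : ∀ x ∈ s, ∀ y ∈ s, dist (f x) (f y) = dist x y) :
    ∃ e : X ≃ᵢ X, Set.EqOn e f s := by
  induction s, hs using Set.Finite.induction_on with
  | empty => exact ⟨IsometryEquiv.refl X, Set.eqOn_empty _ _⟩
  | @insert a s _ _ ih =>
    obtain ⟨e, he⟩ := ih fun x hx y hy => hf x (.inr hx) y (.inr hy)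
    obtain ⟨t, ht⟩ := h a (e.symm (f a))
    obtain ⟨g, hga, hg⟩ := IsUltrametricDist.exists_isometryEquiv_swap t ht
    refine ⟨g.trans e, ?_⟩
    rintro x (rfl | hx)
    · simp [hga]
    · have hx_dist : dist x a = dist x (e.symm (f a)) := by
        rw [← hf x (.inr hx) a (.inl rfl), ← he hx, ← e.dist_eq x, e.apply_symm_apply]
      simp [hg x hx_dist, he hx]

end Homogeneous

namespace UrysohnPt

variable {Λ : Set ℝ}

theorem bddAbove_ne (x y : UrysohnPt Λ) :
    BddAbove ((fun l : Λ => (l : ℝ)) '' {l : Λ | x.1 l ≠ y.1 l}) := by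
  have hfin := ((x.2 1 one_pos).union (y.2 1 one_pos)).image fun l : Λ => (l : ℝ)
  refine (hfin.bddAbove.union (bddAbove_Iic (a := (1 : ℝ)))).mono ?_
  rintro _ ⟨l, hl, rfl⟩
  rcases le_total (l : ℝ) 1 with h | h
  · exact .inr h
  · refine .inl ⟨l, ?_, rfl⟩
    by_contra! hc
    simp only [Set.mem_union, Set.mem_ofPred_eq] at hc hl
    grind

theorem uDist_le_iff (x y : UrysohnPt Λ) {r : ℝ} (hr : 0 ≤ r) :
    uDist x y ≤ r ↔ ∀ l : Λ, x.1 l ≠ y.1 l → (l : ℝ) ≤ r := by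
  refine ⟨fun h l hl => (le_csSup (bddAbove_ne x y) ⟨l, hl, rfl⟩).trans h, fun h => ?_⟩
  refine Real.sSup_le ?_ hr
  rintro _ ⟨l, hl, rfl⟩
  exact h l hl

theorem le_uDist {x y : UrysohnPt Λ} {l : Λ} (hl : x.1 l ≠ y.1 l) : (l : ℝ) ≤ uDist x y :=
  le_csSup (bddAbove_ne x y) ⟨l, hl, rfl⟩

theorem uDist_nonneg (hΛ : ∀ r ∈ Λ, 0 < r) (x y : UrysohnPt Λ) : 0 ≤ uDist x y := by
  refine Real.sSup_nonneg ?_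
  rintro _ ⟨l, -, rfl⟩
  exact (hΛ l l.2).le

theorem uDist_triangle_max (hΛ : ∀ r ∈ Λ, 0 < r) (x y z : UrysohnPt Λ) :
    uDist x z ≤ max (uDist x y) (uDist y z) := by
  refine (uDist_le_iff x z (le_max_of_le_left (uDist_nonneg hΛ x y))).2 fun l hl => ?_
  by_cases h : x.1 l = y.1 l
  · exact le_max_of_le_right (le_uDist (h ▸ hl))
  · exact le_max_of_le_left (le_uDist h)

/-- The metric space structure given by `uDist` when `Λ` consists of positive numbers. -/
noncomputable abbrev metricSpace (hΛ : ∀ r ∈ Λ, 0 < r) : MetricSpace (UrysohnPt Λ) where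
  dist := uDist
  dist_self x := by simp [uDist]
  dist_comm x y := by simp only [uDist, ne_comm]
  dist_triangle x y z := (uDist_triangle_max hΛ x y z).trans
    (max_le_add_of_nonneg (uDist_nonneg hΛ x y) (uDist_nonneg hΛ y z))
  eq_of_dist_eq_zero {x y} h := by
    ext l
    by_contra hl
    exact (hΛ l l.2).not_ge ((le_uDist hl).trans h.le)

theorem isUltrametricDist (hΛ : ∀ r ∈ Λ, 0 < r) :
    letI := metricSpace hΛ
    IsUltrametricDist (UrysohnPt Λ) :=
  letI := metricSpace hΛ
  ⟨uDist_triangle_max hΛ⟩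

/-- Translation by `b - a`. -/
def translate (a b x : UrysohnPt Λ) : UrysohnPt Λ :=
  ⟨fun l => x.1 l + (b.1 l - a.1 l), fun ε hε => by
    refine ((x.2 ε hε).union ((b.2 ε hε).union (a.2 ε hε))).subset ?_
    rintro l ⟨hl, h⟩
    simp only [Set.mem_union, Set.mem_ofPred_eq]
    grind⟩

theorem translate_translate (a b x : UrysohnPt Λ) : translate b a (translate a b x) = x := by
  ext l
  simp only [translate]
  ring

theorem uDist_translate (a b x y : UrysohnPt Λ) :
    uDist (translate a b x) (translate a b y) = uDist x y := by
  simp [uDist, translate]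

theorem exists_isometryEquiv_apply_eq (hΛ : ∀ r ∈ Λ, 0 < r) (a b : UrysohnPt Λ) :
    letI := metricSpace hΛ
    ∃ e : UrysohnPt Λ ≃ᵢ UrysohnPt Λ, e a = b := by
  let := metricSpace hΛ
  refine ⟨⟨⟨translate a b, translate b a, translate_translate a b, translate_translate b a⟩,
    Isometry.of_dist_eq (uDist_translate a b)⟩, ?_⟩
  ext l
  simp [translate]

end UrysohnPt

/-- Ultrahomogeneity of `(M_Λ, uDist)` for countable `Λ ⊆ (0,∞)`: every distance-preserving
bijection between finite subsets `A, B ⊆ M_Λ` extends to a surjective isometry of `M_Λ`. -/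
theorem urysohnSpace_ultrahomogeneous
    (Λ : Set ℝ) (hΛc : Λ.Countable) (hΛ : ∀ r ∈ Λ, 0 < r)
    (A B : Set (UrysohnPt Λ)) (hA : A.Finite) (hB : B.Finite)
    (θ₀ : A → B) (hbij : Function.Bijective θ₀)
    (hθ₀ : ∀ a a' : A, uDist ((θ₀ a : UrysohnPt Λ)) ((θ₀ a' : UrysohnPt Λ))
      = uDist (a : UrysohnPt Λ) (a' : UrysohnPt Λ)) :
    ∃ θ : UrysohnPt Λ → UrysohnPt Λ, Function.Bijective θ ∧
      (∀ ω ω' : UrysohnPt Λ, uDist (θ ω) (θ ω') = uDist ω ω') ∧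
      ∀ a : A, θ (a : UrysohnPt Λ) = (θ₀ a : UrysohnPt Λ) := by
  classical
  let := UrysohnPt.metricSpace hΛ
  have := UrysohnPt.isUltrametricDist hΛ
  obtain ⟨e, he⟩ := exists_isometryEquiv_eqOn_of_homogeneous
    (UrysohnPt.exists_isometryEquiv_apply_eq hΛ) hA
    (f := fun x => if h : x ∈ A then (θ₀ ⟨x, h⟩ : UrysohnPt Λ) else x)
    (fun x hx y hy => by
      simp only [dif_pos hx, dif_pos hy]
      exact hθ₀ ⟨x, hx⟩ ⟨y, hy⟩)
  exact ⟨e, e.bijective, e.dist_eq, fun a => by simpa using he a.2⟩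
end

section
/- Let Λ ⊆ (0,∞), r > 0, and ω₁, ω₂, ω₃ ∈ M_Λ. For the closed ball B^c(ω₁, r) = {ω ∈ M_Λ : d(ω, ω₁) ≤ r}, define the shift γ^{ω₁}_{ω₂} : B^c(ω₁, r) → M_Λ by (γ^{ω₁}_{ω₂} ω)(λ) = ω(λ) for λ ≤ r and (γ^{ω₁}_{ω₂} ω)(λ) = ω₂(λ) for λ > r. Then γ^{ω₁}_{ω₂} maps B^c(ω₁, r) bijectively onto B^c(ω₂, r), preserves distances, and the cocycle identities γ^{ω₂}_{ω₃} ∘ γ^{ω₁}_{ω₂} = γ^{ω₁}_{ω₃} and γ^{ω₁}_{ω₁} = id hold. -/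
/-- The shift `γ^{ω₁}_{ω₂}` (defined by `(γ ω)(λ) = ω(λ)` for `λ ≤ r` and
`(γ ω)(λ) = ω₂(λ)` for `λ > r`); it does not depend on `ω₁`. -/
noncomputable def shiftTo {Λ : Set ℝ} (r : ℝ) (ω₂ ω : UrysohnPt Λ) : UrysohnPt Λ :=
  ⟨fun l => if (l : ℝ) ≤ r then ω.1 l else ω₂.1 l, by
    intro ε hε
    refine ((ω.2 ε hε).union (ω₂.2 ε hε)).subset ?_
    rintro l ⟨hεl, hl⟩
    by_cases h : (l : ℝ) ≤ r
    · exact Or.inl ⟨hεl, by simpa [h] using hl⟩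
    · exact Or.inr ⟨hεl, by simpa [h] using hl⟩⟩

/-- The set of indices at which two points of `M_Λ` differ is bounded above. -/
theorem bddAbove_uDist_set {Λ : Set ℝ} (ω ω' : UrysohnPt Λ) :
    BddAbove ((fun l : Λ => (l : ℝ)) '' {l : Λ | ω.1 l ≠ ω'.1 l}) := by
  obtain ⟨B, hB⟩ := (((ω.2 1 one_pos).union (ω'.2 1 one_pos)).image
    (fun l : Λ => (l : ℝ))).bddAbove
  refine ⟨max B 1, ?_⟩
  rintro _ ⟨l, hl, rfl⟩
  rcases le_total (l : ℝ) 1 with h | h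
  · exact le_max_of_le_right h
  · refine le_max_of_le_left (hB ⟨l, ?_, rfl⟩)
    by_cases h0 : ω.1 l = 0
    · exact Or.inr ⟨h, fun h' => hl (h0.trans h'.symm)⟩
    · exact Or.inl ⟨h, h0⟩

/-- Two points of `M_Λ` are at distance at most `r` iff they agree above `r`. -/
theorem uDist_le_iff {Λ : Set ℝ} {r : ℝ} (hr : 0 ≤ r) (ω ω' : UrysohnPt Λ) :
    uDist ω ω' ≤ r ↔ ∀ l : Λ, r < l → ω.1 l = ω'.1 l := by
  constructor
  · intro h l hl
    by_contra hne
    exact absurd ((le_csSup (bddAbove_uDist_set ω ω') ⟨l, hne, rfl⟩).trans h) (not_le.mpr hl)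
  · intro h
    refine Real.sSup_le ?_ hr
    rintro _ ⟨l, hl, rfl⟩
    exact le_of_not_gt fun hlt => hl (h l hlt)

theorem shiftTo_apply_of_le {Λ : Set ℝ} {r : ℝ} (ω₂ ω : UrysohnPt Λ) {l : Λ}
    (h : (l : ℝ) ≤ r) : (shiftTo r ω₂ ω).1 l = ω.1 l :=
  if_pos h

theorem shiftTo_apply_of_lt {Λ : Set ℝ} {r : ℝ} (ω₂ ω : UrysohnPt Λ) {l : Λ}
    (h : r < (l : ℝ)) : (shiftTo r ω₂ ω).1 l = ω₂.1 l :=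
  if_neg (not_le.mpr h)

/-- The shift towards `ω₂` lands in the closed ball of radius `r` around `ω₂`. -/
theorem uDist_shiftTo_le {Λ : Set ℝ} {r : ℝ} (hr : 0 ≤ r) (ω₂ ω : UrysohnPt Λ) :
    uDist (shiftTo r ω₂ ω) ω₂ ≤ r :=
  (uDist_le_iff hr _ _).mpr fun _ hl => shiftTo_apply_of_lt ω₂ ω hl

theorem shiftTo_shiftTo {Λ : Set ℝ} (r : ℝ) (ω₂ ω₃ ω : UrysohnPt Λ) :
    shiftTo r ω₃ (shiftTo r ω₂ ω) = shiftTo r ω₃ ω := by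
  refine Subtype.ext (funext fun l => ?_)
  rcases le_or_gt (l : ℝ) r with h | h
  · simp only [shiftTo_apply_of_le _ _ h]
  · simp only [shiftTo_apply_of_lt _ _ h]

/-- The shift towards the centre of a ball is the identity on that ball. -/
theorem shiftTo_eq_self {Λ : Set ℝ} {r : ℝ} (hr : 0 ≤ r) {ω₁ ω : UrysohnPt Λ}
    (hω : uDist ω ω₁ ≤ r) : shiftTo r ω₁ ω = ω := by
  refine Subtype.ext (funext fun l => ?_)
  rcases le_or_gt (l : ℝ) r with h | h
  · exact shiftTo_apply_of_le _ _ h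
  · rw [shiftTo_apply_of_lt _ _ h, (uDist_le_iff hr _ _).mp hω l h]

/-- The shift preserves distances between points of a common ball of radius `r`. -/
theorem uDist_shiftTo_shiftTo {Λ : Set ℝ} {r : ℝ} (hr : 0 ≤ r) {ω₁ ω ω' : UrysohnPt Λ}
    (ω₂ : UrysohnPt Λ) (hω : uDist ω ω₁ ≤ r) (hω' : uDist ω' ω₁ ≤ r) :
    uDist (shiftTo r ω₂ ω) (shiftTo r ω₂ ω') = uDist ω ω' := by
  unfold uDist
  congr 2
  ext l
  rcases le_or_gt (l : ℝ) r with h | h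
  · simp only [Set.mem_ofPred_eq, shiftTo_apply_of_le _ _ h]
  · simp only [Set.mem_ofPred_eq, shiftTo_apply_of_lt _ _ h, (uDist_le_iff hr _ _).mp hω l h,
      (uDist_le_iff hr _ _).mp hω' l h, ne_eq, not_true_eq_false]

/-- The canonical shifts between closed balls of radius `r` in `M_Λ`: `γ^{ω₁}_{ω₂}` maps
`B^c(ω₁, r)` bijectively onto `B^c(ω₂, r)`, preserves distances, and the cocycle
identities `γ^{ω₂}_{ω₃} ∘ γ^{ω₁}_{ω₂} = γ^{ω₁}_{ω₃}` and `γ^{ω₁}_{ω₁} = id` hold. -/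
theorem urysohnSpace_shift_properties
    (Λ : Set ℝ) (hΛ : ∀ t ∈ Λ, 0 < t) (r : ℝ) (hr : 0 < r)
    (ω₁ ω₂ ω₃ : UrysohnPt Λ) :
    Set.BijOn (shiftTo r ω₂) {ω : UrysohnPt Λ | uDist ω ω₁ ≤ r}
      {ω : UrysohnPt Λ | uDist ω ω₂ ≤ r} ∧
    (∀ ω ω' : UrysohnPt Λ, uDist ω ω₁ ≤ r → uDist ω' ω₁ ≤ r →
      uDist (shiftTo r ω₂ ω) (shiftTo r ω₂ ω') = uDist ω ω') ∧
    (∀ ω : UrysohnPt Λ, uDist ω ω₁ ≤ r →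
      shiftTo r ω₃ (shiftTo r ω₂ ω) = shiftTo r ω₃ ω) ∧
    (∀ ω : UrysohnPt Λ, uDist ω ω₁ ≤ r → shiftTo r ω₁ ω = ω) := by
  refine ⟨Set.InvOn.bijOn (f' := shiftTo r ω₁) ⟨fun ω hω => ?_, fun ω hω => ?_⟩
    (fun ω _ => uDist_shiftTo_le hr.le ω₂ ω) (fun ω _ => uDist_shiftTo_le hr.le ω₁ ω),
    fun _ _ hω hω' => uDist_shiftTo_shiftTo hr.le ω₂ hω hω',
    fun ω _ => shiftTo_shiftTo r ω₂ ω₃ ω, fun _ hω => shiftTo_eq_self hr.le hω⟩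
  · rw [shiftTo_shiftTo, shiftTo_eq_self hr.le hω]
  · rw [shiftTo_shiftTo, shiftTo_eq_self hr.le hω]
end
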